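/- arXiv:1109.2784 — 4 statements merged into one kernel-verified Lean document; each statement's English description precedes it below -/
import Mathlib

section
/- There exists a constant c > 0 such that for all natural numbers ρ < m and every integer k with 4^ρ < k < 2^{m−1}, one has ∏_{j=ρ+1}^{m} |cos(π·k/2^j)| ≤ k^{−c}. -/
open Finset

/-- The Walsh function `w_A(n) = (-1)^{∑_{j ∈ A} n_j}`, where `n_j` is the `j`-th
binary digit of `n`. -/
noncomputable def walsh (A : Finset ℕ) (n : ℕ) : ℝ :=
  (-1 : ℝ) ^ (∑ j ∈ A, (n / 2 ^ j) % 2)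

/-- The Fourier coefficient `Ŵ(k) = 2^{-λ} ∑_{n < 2^λ} W(n) e(kn/2^λ)` of a function
`W` on `{0, …, 2^λ - 1}`, where `e(t) = exp(2πit)`. -/
noncomputable def dftCoeff (lam : ℕ) (W : ℕ → ℂ) (k : ℤ) : ℂ :=
  (2 ^ lam : ℂ)⁻¹ * ∑ n ∈ Finset.range (2 ^ lam),
    W n * Complex.exp (2 * Real.pi * Complex.I * k * n / 2 ^ lam)

/-- The Walsh–Fourier coefficient `ŵ_A(k)`. -/
noncomputable def walshFourier (lam : ℕ) (A : Finset ℕ) (k : ℤ) : ℂ :=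
  dftCoeff lam (fun n => (walsh A n : ℂ)) k

/-- Telescoping form of Viète's product: iterating `sin (2x) = 2 sin x cos x`. -/
theorem prod_abs_cos_div_two_pow_mul (y : ℝ) {r m : ℕ} (h : r ≤ m) :
    (∏ j ∈ Finset.Ico (r + 1) (m + 1), |Real.cos (y / 2 ^ j)|) *
      (2 ^ m * |Real.sin (y / 2 ^ m)|) = 2 ^ r * |Real.sin (y / 2 ^ r)| := by
  induction m, h using Nat.le_induction with
  | base => simp
  | succ n hn ih =>
    have hdouble : y / 2 ^ n = 2 * (y / 2 ^ (n + 1)) := by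
      rw [pow_succ]
      field_simp
    rw [Finset.prod_Ico_succ_top (by omega), ← ih, hdouble, Real.sin_two_mul, abs_mul, abs_mul,
      abs_two]
    ring

/-- estimate (1.20): `∏_{ρ < j ≤ m} |cos(πk/2^j)| ≤ k^{-c}`
for `4^ρ < k < 2^{m-1}`. -/
theorem cos_prod_bound :
    ∃ c : ℝ, 0 < c ∧
      ∀ ρ m : ℕ, ρ < m → ∀ k : ℕ, 4 ^ ρ < k → k < 2 ^ (m - 1) →
        ∏ j ∈ Finset.Ico (ρ + 1) (m + 1), |Real.cos (Real.pi * k / 2 ^ j)|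
          ≤ (k : ℝ) ^ (-c) := by
  refine ⟨1 / 2, by norm_num, fun ρ m hρm k hρk hkm => ?_⟩
  have hk : (0 : ℝ) < k := by exact_mod_cast (Nat.zero_le _).trans_lt hρk
  have hkm' : 2 * (k : ℝ) ≤ 2 ^ m := by
    have h : 2 * k ≤ 2 ^ m := by
      obtain ⟨n, rfl⟩ : ∃ n, m = n + 1 := ⟨m - 1, by omega⟩
      rw [Nat.add_sub_cancel] at hkm
      rw [pow_succ]
      omega
    exact_mod_cast h
  have hsin : 2 * (k : ℝ) ≤ 2 ^ m * |Real.sin (Real.pi * k / 2 ^ m)| := by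
    have h := Real.mul_le_sin (x := Real.pi * k / 2 ^ m) (by positivity) (by
      rw [div_le_div_iff₀ (by positivity) two_pos]
      nlinarith [Real.pi_pos])
    calc 2 * (k : ℝ) = 2 ^ m * (2 / Real.pi * (Real.pi * k / 2 ^ m)) := by
          field_simp
      _ ≤ 2 ^ m * |Real.sin (Real.pi * k / 2 ^ m)| := by
          gcongr
          exact h.trans (le_abs_self _)
  have hsqrt : (2 : ℝ) ^ ρ ≤ √k := by
    apply Real.le_sqrt_of_sq_le
    rw [← pow_mul, mul_comm, pow_mul]
    norm_num
    exact_mod_cast hρk.le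
  rw [Real.rpow_neg hk.le, ← Real.sqrt_eq_rpow]
  have hprod := prod_abs_cos_div_two_pow_mul (Real.pi * k) hρm.le
  set P := ∏ j ∈ Finset.Ico (ρ + 1) (m + 1), |Real.cos (Real.pi * k / 2 ^ j)|
  have hP : 0 ≤ P := Finset.prod_nonneg fun _ _ => abs_nonneg _
  have hs : 0 < √(k : ℝ) := Real.sqrt_pos.2 hk
  have hle : P * (2 * k) ≤ √k :=
    calc P * (2 * k) ≤ 2 ^ ρ * |Real.sin (Real.pi * k / 2 ^ ρ)| :=
          hprod ▸ mul_le_mul_of_nonneg_left hsin hP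
      _ ≤ 2 ^ ρ * 1 := by
          gcongr
          exact Real.abs_sin_le_one _
      _ ≤ √k := by rwa [mul_one]
  rw [← one_div, le_div_iff₀ hs]
  have hbound : P * √k * √k ≤ 1 * √k := by
    rw [mul_assoc, Real.mul_self_sqrt hk.le]
    nlinarith [mul_nonneg hP hk.le]
  exact le_of_mul_le_mul_right hbound hs
end

section
/- For every real number θ, one has √(1 + |sin θ|)·|cos θ| + √(1 + |cos θ|)·|sin θ| ≤ √(2 + √2). -/
open Finset

/-- For `a ^ 2 + b ^ 2 = 1` the quantity `(1 + a) * (1 + b)` is half the square of `a + b + 1`. -/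
theorem sqrt_one_add_mul_sqrt_one_add {a b : ℝ} (ha : 0 ≤ a) (hb : 0 ≤ b)
    (h : a ^ 2 + b ^ 2 = 1) :
    Real.sqrt (1 + a) * Real.sqrt (1 + b) = Real.sqrt 2 / 2 * (a + b + 1) := by
  rw [← Real.sqrt_mul (by positivity), Real.sqrt_eq_iff_mul_self_eq (by positivity) (by positivity)]
  linear_combination -(a + b + 1) ^ 2 / 4 * Real.sq_sqrt (zero_le_two (α := ℝ)) - h / 2

theorem sqrt_one_add_mul_add_le {a b : ℝ} (ha : 0 ≤ a) (hb : 0 ≤ b) (h : a ^ 2 + b ^ 2 = 1) :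
    Real.sqrt (1 + a) * b + Real.sqrt (1 + b) * a ≤ Real.sqrt (2 + Real.sqrt 2) := by
  apply Real.le_sqrt_of_sq_le
  have h2 : Real.sqrt 2 ^ 2 = 2 := Real.sq_sqrt zero_le_two
  have hab : a * b ≤ 1 / 2 := by linarith [two_mul_le_add_sq a b]
  have hsum : a + b ≤ Real.sqrt 2 := Real.le_sqrt_of_sq_le (by linarith [add_sq a b])
  calc (Real.sqrt (1 + a) * b + Real.sqrt (1 + b) * a) ^ 2
      = 1 + a * b * (a + b + Real.sqrt 2 * (a + b + 1)) := by
        linear_combination b ^ 2 * Real.sq_sqrt (by positivity : 0 ≤ 1 + a) +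
          a ^ 2 * Real.sq_sqrt (by positivity : 0 ≤ 1 + b) +
          2 * a * b * sqrt_one_add_mul_sqrt_one_add ha hb h + h
    _ ≤ 1 + 1 / 2 * (Real.sqrt 2 + Real.sqrt 2 * (Real.sqrt 2 + 1)) := by gcongr
    _ = 2 + Real.sqrt 2 := by linear_combination h2 / 2

/-- the key pointwise trigonometric inequality. -/
theorem sqrt_one_add_sin_cos_inequality (θ : ℝ) :
    Real.sqrt (1 + |Real.sin θ|) * |Real.cos θ|
      + Real.sqrt (1 + |Real.cos θ|) * |Real.sin θ|
      ≤ Real.sqrt (2 + Real.sqrt 2) := by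
  exact sqrt_one_add_mul_add_le (abs_nonneg _) (abs_nonneg _)
    (by simp only [sq_abs, Real.sin_sq_add_cos_sq])
end

section
/- There exist constants c > 0 and C > 0 such that for every λ ∈ ℕ with λ ≥ 2, every subset S ⊆ {0,…,λ−1}, and all μ, ν ∈ ℕ with μ + ν = λ, one has (type-I sum estimate) ∑_{2^μ ≤ m < 2^{μ+1}} |∑_{2^ν ≤ n < 2^{ν+1}} w_S(m·n)| ≤ C·(λ²·2^ν·2^{2μ}·2^{−c·|S|} + 1). -/
open Finset

/-- Adding the binary digit at a fresh top position `L` flips the sign exactly when `L ∈ S`. -/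
theorem walsh_add_two_pow (S : Finset ℕ) {L x : ℕ} (hx : x < 2 ^ L) :
    walsh S (x + 2 ^ L) = (if L ∈ S then -1 else 1) * walsh S x := by
  have key : ∀ j, (x + 2 ^ L) / 2 ^ j % 2 = x / 2 ^ j % 2 + if j = L then 1 else 0 := by
    intro j
    rcases lt_trichotomy j L with h | rfl | h
    · obtain ⟨k, rfl⟩ := Nat.exists_eq_add_of_lt h
      have e : x + 2 ^ (j + k + 1) = x + 2 ^ j * (2 * 2 ^ k) := by ring
      rw [e, Nat.add_mul_div_left _ _ (by positivity), if_neg (by omega)]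
      omega
    · rw [Nat.add_div_right _ (by positivity), Nat.div_eq_of_lt hx]
      simp
    · have h1 : 2 ^ (L + 1) ≤ 2 ^ j := Nat.pow_le_pow_right (by norm_num) h
      rw [pow_succ] at h1
      rw [Nat.div_eq_of_lt (by omega), Nat.div_eq_of_lt (by omega), if_neg (by omega)]
  unfold walsh
  simp_rw [key, sum_add_distrib, sum_ite_eq', pow_add]
  split_ifs <;> simp

theorem abs_walsh (S : Finset ℕ) (x : ℕ) : |walsh S x| = 1 := by
  simp [walsh, abs_pow]

/-- The Walsh function twisted by powers of `z`, summed over an initial segment. -/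
noncomputable def twistedWalshSum (S : Finset ℕ) (z : ℂ) (X : ℕ) : ℂ :=
  ∑ x ∈ range X, (walsh S x : ℂ) * z ^ x

/-- The factor contributed by the digit at position `L` to the twisted sum. -/
noncomputable def digitFactor (S : Finset ℕ) (z : ℂ) (L : ℕ) : ℂ :=
  1 + (if L ∈ S then -1 else 1) * z ^ 2 ^ L

theorem twistedWalshSum_two_pow_add (S : Finset ℕ) (z : ℂ) {L Y : ℕ} (hY : Y ≤ 2 ^ L) :
    twistedWalshSum S z (2 ^ L + Y) = twistedWalshSum S z (2 ^ L) +
      (if L ∈ S then -1 else 1) * z ^ 2 ^ L * twistedWalshSum S z Y := by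
  unfold twistedWalshSum
  rw [sum_range_add, mul_sum]
  congr 1
  refine sum_congr rfl fun x hx => ?_
  rw [add_comm, walsh_add_two_pow S ((mem_range.mp hx).trans_le hY), pow_add]
  push_cast
  split_ifs <;> push_cast <;> ring

theorem twistedWalshSum_two_pow_succ (S : Finset ℕ) (z : ℂ) (L : ℕ) :
    twistedWalshSum S z (2 ^ (L + 1)) = twistedWalshSum S z (2 ^ L) * digitFactor S z L := by
  rw [pow_succ, mul_two, twistedWalshSum_two_pow_add S z le_rfl, digitFactor]
  ring

theorem norm_digitFactor_le_two (S : Finset ℕ) {z : ℂ} (hz : ‖z‖ = 1) (L : ℕ) :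
    ‖digitFactor S z L‖ ≤ 2 := by
  refine (norm_add_le _ _).trans ?_
  split_ifs <;> norm_num [hz]

theorem norm_one_sub_sq_add_norm_one_add_sq {z : ℂ} (hz : ‖z‖ = 1) :
    ‖1 - z‖ ^ 2 + ‖1 + z‖ ^ 2 = 4 := by
  have := parallelogram_law_with_norm ℝ (1 : ℂ) z
  rw [hz, norm_one] at this
  nlinarith

theorem sq_mul_le_of_sq_add_sq_eq_four {a b : ℝ} (hb : 0 ≤ b) (h : a ^ 2 + b ^ 2 = 4) :
    a ^ 2 * b ≤ 81 / 25 := by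
  have : a ^ 2 = 4 - b ^ 2 := by linarith
  rw [this]
  nlinarith [mul_nonneg hb (sq_nonneg (b - 23 / 20)), sq_nonneg (b - 23 / 20)]

theorem norm_digitFactor_mul_succ_le (S : Finset ℕ) {z : ℂ} (hz : ‖z‖ = 1) (L : ℕ) :
    ‖digitFactor S z L‖ * ‖digitFactor S z (L + 1)‖ ≤
      4 * (81 / 100) ^ (if L + 1 ∈ S then 1 else 0) := by
  by_cases h : L + 1 ∈ S
  · set u := z ^ 2 ^ L with hu
    have hu1 : ‖u‖ = 1 := by simp [hu, hz]
    have e : digitFactor S z (L + 1) = (1 - u) * (1 + u) := by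
      simp only [digitFactor, h, if_true, hu]
      ring
    have hsq := norm_one_sub_sq_add_norm_one_add_sq hu1
    have h1 := sq_mul_le_of_sq_add_sq_eq_four (norm_nonneg (1 + u)) hsq
    have h2 := sq_mul_le_of_sq_add_sq_eq_four (norm_nonneg (1 - u)) ((add_comm _ _).trans hsq)
    rw [e, norm_mul, if_pos h]
    by_cases h' : L ∈ S
    · have e' : digitFactor S z L = 1 - u := by
        simp only [digitFactor, h', if_true, hu]
        ring
      rw [e']
      linarith
    · have e' : digitFactor S z L = 1 + u := by
        simp only [digitFactor, h', if_false, hu]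
        ring
      rw [e']
      linarith
  · rw [if_neg h]
    nlinarith [norm_digitFactor_le_two S hz L, norm_digitFactor_le_two S hz (L + 1),
      norm_nonneg (digitFactor S z L), norm_nonneg (digitFactor S z (L + 1))]

theorem card_inter_range_succ (S : Finset ℕ) (L : ℕ) :
    #(S ∩ range (L + 1)) = #(S ∩ range L) + if L ∈ S then 1 else 0 := by
  rw [range_add_one]
  split_ifs with h
  · rw [inter_insert_of_mem h, card_insert_of_notMem (by simp)]
  · rw [inter_insert_of_notMem h, add_zero]

theorem norm_twistedWalshSum_two_pow_mul_succ_le (S : Finset ℕ) {z : ℂ} (hz : ‖z‖ = 1) (L : ℕ) :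
    81 / 100 * (‖twistedWalshSum S z (2 ^ L)‖ * ‖twistedWalshSum S z (2 ^ (L + 1))‖) ≤
      2 * 4 ^ L * (81 / 100) ^ #(S ∩ range (L + 1)) := by
  induction L with
  | zero =>
    have h1 : ‖twistedWalshSum S z (2 ^ 0)‖ = 1 := by
      simp only [twistedWalshSum, pow_zero, sum_range_one, mul_one, Complex.norm_real,
        Real.norm_eq_abs, abs_walsh]
    have h2 := norm_digitFactor_le_two S hz 0
    rw [twistedWalshSum_two_pow_succ, norm_mul, h1, card_inter_range_succ]
    split_ifs <;> simp <;> linarith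
  | succ L ih =>
    rw [twistedWalshSum_two_pow_succ S z (L + 1), card_inter_range_succ S (L + 1),
      pow_add (81 / 100 : ℝ), norm_mul]
    have e : ‖twistedWalshSum S z (2 ^ (L + 1))‖ =
        ‖twistedWalshSum S z (2 ^ L)‖ * ‖digitFactor S z L‖ := by
      rw [twistedWalshSum_two_pow_succ, norm_mul]
    have h := mul_le_mul ih (norm_digitFactor_mul_succ_le S hz L) (by positivity) (by positivity)
    refine (le_of_eq ?_).trans (h.trans_eq ?_)
    · rw [e]
      ring
    · ring

theorem norm_twistedWalshSum_two_pow_le (S : Finset ℕ) {z : ℂ} (hz : ‖z‖ = 1) (L : ℕ) :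
    9 / 10 * ‖twistedWalshSum S z (2 ^ L)‖ ≤ 2 ^ L * (9 / 10) ^ #(S ∩ range L) := by
  cases L with
  | zero =>
    simp only [twistedWalshSum, pow_zero, sum_range_one, mul_one, Complex.norm_real,
        Real.norm_eq_abs, abs_walsh]
    norm_num
  | succ L =>
    refine (sq_le_sq₀ (by positivity) (by positivity)).mp ?_
    have h := norm_twistedWalshSum_two_pow_mul_succ_le S hz L
    have h2 := norm_digitFactor_le_two S hz L
    have h3 : ‖twistedWalshSum S z (2 ^ (L + 1))‖ ≤ ‖twistedWalshSum S z (2 ^ L)‖ * 2 := by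
      rw [twistedWalshSum_two_pow_succ, norm_mul]
      gcongr
    have e : ((2 : ℝ) ^ (L + 1) * (9 / 10) ^ #(S ∩ range (L + 1))) ^ 2 =
        2 * (2 * 4 ^ L * (81 / 100) ^ #(S ∩ range (L + 1))) := by
      rw [mul_pow, ← pow_mul, ← pow_mul, mul_comm (L + 1), mul_comm #_, pow_mul, pow_mul]
      norm_num [pow_succ]
      ring
    rw [e]
    nlinarith [mul_le_mul_of_nonneg_left h3 (norm_nonneg (twistedWalshSum S z (2 ^ (L + 1))))]

theorem norm_twistedWalshSum_le (S : Finset ℕ) {z : ℂ} (hz : ‖z‖ = 1) (L : ℕ) :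
    ∀ X ≤ 2 ^ L, ‖twistedWalshSum S z X‖ ≤ 2 * 2 ^ L * (9 / 10) ^ #(S ∩ range L) := by
  induction L with
  | zero =>
    intro X hX
    rw [pow_zero] at hX
    interval_cases X
    · simp [twistedWalshSum]
    · simp only [twistedWalshSum, sum_range_one, pow_zero, mul_one, Complex.norm_real,
        Real.norm_eq_abs, abs_walsh]
      norm_num
  | succ L ih =>
    intro X hX
    have hF := norm_twistedWalshSum_two_pow_le S hz L
    have hr : (9 / 10 : ℝ) * (9 / 10) ^ #(S ∩ range L) ≤ (9 / 10) ^ #(S ∩ range (L + 1)) := by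
      rw [card_inter_range_succ]
      have := pow_pos (show (0 : ℝ) < 9 / 10 by norm_num) #(S ∩ range L)
      split_ifs
      · rw [pow_succ, mul_comm]
      · rw [add_zero]
        linarith
    have hr' := mul_le_mul_of_nonneg_left hr (show (0 : ℝ) ≤ 4 * 2 ^ L by positivity)
    have hpos : (0 : ℝ) ≤ 2 ^ L * (9 / 10) ^ #(S ∩ range L) := by positivity
    suffices ‖twistedWalshSum S z X‖ ≤
        ‖twistedWalshSum S z (2 ^ L)‖ + 2 * 2 ^ L * (9 / 10) ^ #(S ∩ range L) by
      rw [pow_succ]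
      nlinarith
    rcases le_total X (2 ^ L) with h | h
    · exact (ih X h).trans (le_add_of_nonneg_left (norm_nonneg _))
    · obtain ⟨Y, rfl⟩ := Nat.exists_eq_add_of_le h
      have hY : Y ≤ 2 ^ L := by
        rw [pow_succ] at hX
        omega
      rw [twistedWalshSum_two_pow_add S z hY]
      refine (norm_add_le _ _).trans (add_le_add_right ?_ _)
      have e : ‖(if L ∈ S then (-1 : ℂ) else 1)‖ = 1 := by split_ifs <;> simp
      rw [norm_mul, norm_mul, norm_pow, hz, one_pow, e, one_mul, one_mul]
      exact ih Y hY

theorem sum_range_pow_mul_primitiveRoot {m : ℕ} {ζ : ℂ} (hζ : IsPrimitiveRoot ζ m) (x : ℕ) :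
    ∑ a ∈ range m, (ζ ^ a) ^ x = if m ∣ x then (m : ℂ) else 0 := by
  simp_rw [← pow_mul, mul_comm _ x, pow_mul]
  split_ifs with h
  · rw [(hζ.pow_eq_one_iff_dvd x).mpr h]
    simp
  · have h1 : ζ ^ x ≠ 1 := fun h' => h ((hζ.pow_eq_one_iff_dvd x).mp h')
    rw [geom_sum_eq h1, ← pow_mul, mul_comm, pow_mul, hζ.pow_eq_one, one_pow, sub_self, zero_div]

theorem sum_range_mul_eq_sum_filter_dvd (f : ℕ → ℂ) {m : ℕ} (hm : 0 < m) (A : ℕ) :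
    ∑ y ∈ range A, f (m * y) = ∑ x ∈ range (m * A), if m ∣ x then f x else 0 := by
  rw [← sum_filter]
  refine sum_bij (fun y _ => m * y) ?_ ?_ ?_ fun _ _ => rfl
  · intro y hy
    simpa [hm] using hy
  · intro y _ y' _ h
    exact Nat.eq_of_mul_eq_mul_left hm h
  · intro x hx
    obtain ⟨hx, y, rfl⟩ := mem_filter.mp hx
    exact ⟨y, by simpa [hm] using hx, rfl⟩

/-- Sums of a Walsh function along multiples of `m` inherit the bound for twisted sums. -/
theorem abs_sum_range_walsh_mul_le (S : Finset ℕ) {m : ℕ} (hm : 0 < m) {L A : ℕ}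
    (hA : m * A ≤ 2 ^ L) :
    |∑ y ∈ range A, walsh S (m * y)| ≤ 2 * 2 ^ L * (9 / 10) ^ #(S ∩ range L) := by
  have hζ := Complex.isPrimitiveRoot_exp m hm.ne'
  set ζ := Complex.exp (2 * Real.pi * Complex.I / m)
  have hnorm : ‖ζ‖ = 1 := hζ.norm'_eq_one hm.ne'
  have key : (m : ℂ) * ∑ y ∈ range A, (walsh S (m * y) : ℂ) =
      ∑ a ∈ range m, twistedWalshSum S (ζ ^ a) (m * A) := by
    rw [sum_range_mul_eq_sum_filter_dvd (fun x => (walsh S x : ℂ)) hm, mul_sum]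
    simp only [twistedWalshSum]
    rw [sum_comm]
    refine sum_congr rfl fun x _ => ?_
    rw [← mul_sum, sum_range_pow_mul_primitiveRoot hζ]
    split_ifs <;> simp [mul_comm]
  have hle : ‖(m : ℂ) * ∑ y ∈ range A, (walsh S (m * y) : ℂ)‖ ≤
      m * (2 * 2 ^ L * (9 / 10) ^ #(S ∩ range L)) := by
    rw [key]
    refine (norm_sum_le_of_le _ fun a _ => norm_twistedWalshSum_le S ?_ L _ hA).trans_eq ?_
    · rw [norm_pow, hnorm, one_pow]
    · simp
  rw [norm_mul, Complex.norm_natCast, ← Complex.ofReal_sum, Complex.norm_real,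
    Real.norm_eq_abs] at hle
  exact le_of_mul_le_mul_left hle (by exact_mod_cast hm)

theorem nine_tenths_pow_le_two_rpow (k : ℕ) :
    (9 / 10 : ℝ) ^ k ≤ (2 : ℝ) ^ (-(1 / 10 * k : ℝ)) := by
  rw [← neg_mul, Real.rpow_mul_natCast (by norm_num)]
  refine pow_le_pow_left₀ (by norm_num) ?_ k
  refine le_of_pow_le_pow_left₀ (n := 10) (by norm_num) (by positivity) ?_
  rw [← Real.rpow_mul_natCast (by norm_num)]
  norm_num [Real.rpow_neg_one]

/-- type-I sum estimate (3.2')–(3.3). -/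
theorem typeI_sum_estimate :
    ∃ c C : ℝ, 0 < c ∧ 0 < C ∧
      ∀ lam : ℕ, 2 ≤ lam → ∀ S ⊆ Finset.range lam, ∀ m n : ℕ, m + n = lam →
        ∑ x ∈ Finset.Ico (2 ^ m) (2 ^ (m + 1)),
            |∑ y ∈ Finset.Ico (2 ^ n) (2 ^ (n + 1)), walsh S (x * y)|
          ≤ C * ((lam : ℝ) ^ 2 * 2 ^ n * 2 ^ (2 * m) * (2 : ℝ) ^ (-(c * S.card)) + 1) := by
  refine ⟨1 / 10, 16, by norm_num, by norm_num, ?_⟩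
  rintro lam hlam S hS m n rfl
  have hinter : S ∩ range (m + n + 2) = S :=
    inter_eq_left.mpr (hS.trans (range_subset_range.mpr (by omega)))
  have hx : ∀ x ∈ Ico (2 ^ m) (2 ^ (m + 1)),
      |∑ y ∈ Ico (2 ^ n) (2 ^ (n + 1)), walsh S (x * y)| ≤
        16 * 2 ^ (m + n) * (9 / 10) ^ #S := by
    intro x hx
    obtain ⟨h1, h2⟩ := mem_Ico.mp hx
    have hx0 : 0 < x := (Nat.two_pow_pos m).trans_le h1
    have hle : 2 ^ n ≤ 2 ^ (n + 1) := Nat.pow_le_pow_right (by norm_num) n.le_succ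
    have hb : x * 2 ^ (n + 1) ≤ 2 ^ (m + n + 2) :=
      (Nat.mul_le_mul_right _ h2.le).trans_eq (by ring)
    have b1 := abs_sum_range_walsh_mul_le S hx0 hb
    have b2 := abs_sum_range_walsh_mul_le S hx0 ((Nat.mul_le_mul_left x hle).trans hb)
    rw [hinter] at b1 b2
    rw [sum_Ico_eq_sub _ hle]
    refine ((abs_sub _ _).trans (add_le_add b1 b2)).trans_eq ?_
    ring
  refine (sum_le_sum hx).trans ?_
  have hcard : #(Ico (2 ^ m) (2 ^ (m + 1))) = 2 ^ m := by
    rw [Nat.card_Ico, pow_succ]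
    omega
  have hlam' : (1 : ℝ) ≤ ((m + n : ℕ) : ℝ) ^ 2 := one_le_pow₀ (by exact_mod_cast (by omega))
  have hpos : (0 : ℝ) ≤ 2 ^ n * 2 ^ (2 * m) * (2 : ℝ) ^ (-(1 / 10 * #S : ℝ)) := by positivity
  rw [sum_const, hcard, nsmul_eq_mul]
  calc ((2 ^ m : ℕ) : ℝ) * (16 * 2 ^ (m + n) * (9 / 10) ^ #S)
      = 16 * (2 ^ n * 2 ^ (2 * m) * (9 / 10) ^ #S) := by
        push_cast
        ring
    _ ≤ 16 * (2 ^ n * 2 ^ (2 * m) * (2 : ℝ) ^ (-(1 / 10 * #S : ℝ))) := by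
        gcongr
        exact nine_tenths_pow_le_two_rpow _
    _ ≤ _ := by nlinarith
end

section
/- There exist constants c > 0 and C > 0 with the following property (refined type-I estimate): for all sufficiently large λ ∈ ℕ, every real H with C ≤ H ≤ λ^{1/10}, all μ, ν ∈ ℕ with μ + ν = λ, H < μ ≤ C·H²·λ^{1/2} and 2μ < λ, and every subset S ⊆ {0,…,λ−1} such that |S ∩ [λ−2μ, λ)| ≤ C·H and |S ∩ [0, λ−2μ)| ≥ λ^{1/2}/H, one has ∑_{2^μ ≤ m < 2^{μ+1}} |∑_{2^ν ≤ n < 2^{ν+1}} w_S(m·n)| ≤ 2^{λ − c·λ^{1/2}/H}. -/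
open Finset

/-- The additive character `e(θ) = exp(2πiθ)`. -/
noncomputable def addExp (θ : ℝ) : ℂ := Complex.exp ((2 * Real.pi * θ : ℝ) * Complex.I)

lemma addExp_add (a b : ℝ) : addExp (a + b) = addExp a * addExp b := by
  simp only [addExp, ← Complex.exp_add]
  congr 1
  push_cast
  ring

lemma norm_addExp (a : ℝ) : ‖addExp a‖ = 1 := Complex.norm_exp_ofReal_mul_I _

lemma addExp_int (k : ℤ) : addExp k = 1 := by
  rw [addExp, Complex.exp_eq_one_iff]
  exact ⟨k, by push_cast; ring⟩

lemma addExp_zero : addExp 0 = 1 := by simp [addExp]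

lemma addExp_nat_mul (a : ℝ) (k : ℕ) : addExp (k * a) = addExp a ^ k := by
  rw [addExp, addExp, ← Complex.exp_nat_mul]
  congr 1
  push_cast
  ring

lemma addExp_eq_one_iff {a : ℝ} : addExp a = 1 ↔ ∃ k : ℤ, a = k := by
  refine ⟨fun h => ?_, ?_⟩
  · rw [addExp, Complex.exp_eq_one_iff] at h
    obtain ⟨k, hk⟩ := h
    refine ⟨k, ?_⟩
    have hpi : (2 * Real.pi * Complex.I : ℂ) ≠ 0 := by
      simp [Real.pi_ne_zero, Complex.I_ne_zero]
    have : (2 * Real.pi * Complex.I : ℂ) * a = (2 * Real.pi * Complex.I : ℂ) * k := by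
      rw [mul_comm _ (k : ℂ), ← hk]
      push_cast
      ring
    exact_mod_cast mul_left_cancel₀ hpi this
  · rintro ⟨k, rfl⟩
    exact addExp_int k

lemma normSq_one_add_mul_addExp (s a : ℝ) (hs : s ^ 2 = 1) :
    ‖1 + (s : ℂ) * addExp a‖ ^ 2 = 2 + 2 * s * Real.cos (2 * Real.pi * a) := by
  rw [← Complex.normSq_eq_norm_sq, addExp, Complex.exp_mul_I, ← Complex.ofReal_cos,
    ← Complex.ofReal_sin, Complex.normSq_apply]
  simp only [Complex.add_re, Complex.one_re, Complex.mul_re, Complex.ofReal_re, Complex.ofReal_im,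
    Complex.I_re, Complex.I_im, Complex.add_im, Complex.one_im, Complex.mul_im]
  have := Real.sin_sq_add_cos_sq (2 * Real.pi * a)
  linear_combination s ^ 2 * this + hs

/-- The kernel `∑_{y < K} e(γ y)` is at most `1 / (2γ) + 1 / (2(1 - γ))` for `0 < γ < 1`. -/
lemma norm_sum_addExp_le (K : ℕ) {γ : ℝ} (h0 : 0 < γ) (h1 : γ < 1) :
    ‖∑ y ∈ range K, addExp (y * γ)‖ ≤ 1 / (2 * γ) + 1 / (2 * (1 - γ)) := by
  have hsin : 2 * min γ (1 - γ) ≤ Real.sin (Real.pi * γ) := by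
    have hpi := Real.pi_pos
    rcases le_total γ (1 / 2) with h | h
    · have := Real.mul_le_sin (x := Real.pi * γ) (by positivity) (by nlinarith)
      have h2 : 2 / Real.pi * (Real.pi * γ) = 2 * γ := by field_simp
      have h3 := min_le_left γ (1 - γ)
      linarith
    · have := Real.mul_le_sin (x := Real.pi * (1 - γ)) (by nlinarith) (by nlinarith)
      have h2 : 2 / Real.pi * (Real.pi * (1 - γ)) = 2 * (1 - γ) := by field_simp
      have h3 := min_le_right γ (1 - γ)
      have h4 : Real.sin (Real.pi * (1 - γ)) = Real.sin (Real.pi * γ) := by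
        rw [mul_sub, mul_one, Real.sin_pi_sub]
      linarith
  have hmin : 0 < min γ (1 - γ) := lt_min h0 (by linarith)
  have hne : ‖addExp γ - 1‖ = 2 * Real.sin (Real.pi * γ) := by
    have h := normSq_one_add_mul_addExp (-1) γ (by norm_num)
    have hc : Real.cos (2 * Real.pi * γ) = 1 - 2 * Real.sin (Real.pi * γ) ^ 2 := by
      rw [mul_assoc, Real.cos_two_mul, Real.cos_sq']
      ring
    have h' : ‖addExp γ - 1‖ ^ 2 = (2 * Real.sin (Real.pi * γ)) ^ 2 := by
      rw [← norm_neg, show -(addExp γ - 1) = 1 + ((-1 : ℝ) : ℂ) * addExp γ by push_cast; ring, h, hc]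
      ring
    exact (pow_left_inj₀ (norm_nonneg _) (by linarith) two_ne_zero).1 h'
  have hgeo : (∑ y ∈ range K, addExp (y * γ)) * (addExp γ - 1) = addExp γ ^ K - 1 := by
    simp only [addExp_nat_mul]
    exact geom_sum_mul _ _
  have hle : ‖∑ y ∈ range K, addExp (y * γ)‖ * (2 * Real.sin (Real.pi * γ)) ≤ 2 := by
    rw [← hne, ← norm_mul, hgeo]
    refine (norm_sub_le _ _).trans ?_
    rw [norm_pow, norm_addExp]
    norm_num
  have hle2 : ‖∑ y ∈ range K, addExp (y * γ)‖ ≤ 1 / (2 * min γ (1 - γ)) := by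
    rw [le_div_iff₀ (by positivity)]
    nlinarith [norm_nonneg (∑ y ∈ range K, addExp (y * γ))]
  refine hle2.trans ?_
  have hγ : 0 < 1 / (2 * γ) := by positivity
  have hγ' : 0 < 1 / (2 * (1 - γ)) := by
    have : 0 < 1 - γ := by linarith
    positivity
  rcases min_choice γ (1 - γ) with h | h <;> rw [h] <;> linarith

lemma sum_range_comp_of_injOn {M : Type*} [AddCommMonoid M] {N : ℕ} (σ : ℕ → ℕ)
    (hmaps : ∀ k < N, σ k < N) (hinj : ∀ k < N, ∀ l < N, σ k = σ l → k = l) (f : ℕ → M) :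
    ∑ k ∈ range N, f (σ k) = ∑ k ∈ range N, f k := by
  have himg : (range N).image σ = range N := by
    refine eq_of_subset_of_card_le ?_ ?_
    · intro a ha
      obtain ⟨k, hk, rfl⟩ := mem_image.1 ha
      exact mem_range.2 (hmaps k (mem_range.1 hk))
    · rw [card_image_of_injOn]
      intro a ha b hb h
      exact hinj a (by simpa using ha) b (by simpa using hb) h
  conv_rhs => rw [← himg]
  rw [sum_image]
  intro a ha b hb h
  exact hinj a (by simpa using ha) b (by simpa using hb) h

/-- Up to a constant, the `L¹` norm of the Dirichlet kernel on a shifted lattice is logarithmic. -/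
lemma sum_norm_kernel_le (r K : ℕ) (hK : K ≤ 2 ^ r) (β : ℝ) :
    ∑ h ∈ range (2 ^ r), ‖∑ y ∈ range K, addExp (y * (β - h / 2 ^ r))‖
      ≤ 2 ^ r * (4 * (1 + r)) := by
  obtain ⟨N, hN⟩ : ∃ N : ℕ, N = 2 ^ r := ⟨_, rfl⟩
  have hN0 : 0 < N := hN ▸ Nat.two_pow_pos r
  have hNR : (0 : ℝ) < N := by exact_mod_cast hN0
  have hcast : (2 : ℝ) ^ r = N := by rw [hN]; push_cast; ring
  rw [hcast, ← hN]
  rw [← hN] at hK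
  set b : ℤ := ⌊(N : ℝ) * β⌋ with hb
  set t : ℝ := Int.fract ((N : ℝ) * β) with ht
  have ht0 : 0 ≤ t := Int.fract_nonneg _
  have ht1 : t < 1 := Int.fract_lt_one _
  have hβ : (N : ℝ) * β = b + t := (Int.floor_add_fract _).symm
  set φ : ℕ → ℝ := fun k => ‖∑ y ∈ range K, addExp (y * ((k + t) / N))‖ with hφ
  set σ : ℕ → ℕ := fun h => ((b - h) % (N : ℤ)).toNat with hσ
  have hσnn : ∀ h : ℕ, 0 ≤ (b - h) % (N : ℤ) := fun h => Int.emod_nonneg _ (by omega)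
  have hσlt : ∀ h : ℕ, (b - h) % (N : ℤ) < N := fun h => Int.emod_lt_of_pos _ (by omega)
  have hσc : ∀ h : ℕ, ((σ h : ℕ) : ℤ) = (b - h) % (N : ℤ) := fun h => Int.toNat_of_nonneg (hσnn h)
  have hmaps : ∀ h < N, σ h < N := fun h _ => by
    have := hσlt h
    rw [← hσc] at this
    exact_mod_cast this
  have hinj : ∀ k < N, ∀ l < N, σ k = σ l → k = l := by
    intro k hk l hl h
    have h' : (b - k) % (N : ℤ) = (b - l) % (N : ℤ) := by rw [← hσc, ← hσc, h]
    have h2 : (N : ℤ) ∣ (b - l) - (b - k) := Int.ModEq.dvd h'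
    have h3 : (N : ℤ) ∣ (k : ℤ) - l := by simpa using h2
    have h4 := Int.eq_zero_of_abs_lt_dvd h3 (by rw [abs_lt]; omega)
    omega
  have hterm : ∀ h ∈ range N, ‖∑ y ∈ range K, addExp (y * (β - h / N))‖ = φ (σ h) := by
    intro h _
    simp only [hφ]
    congr 1
    refine sum_congr rfl fun y _ => ?_
    have hd := Int.mul_ediv_add_emod (b - h) N
    rw [← hσc] at hd
    have hdR : (N : ℝ) * (((b - h) / (N : ℤ) : ℤ) : ℝ) + (σ h : ℕ) = b - h := by exact_mod_cast hd
    have : (y : ℝ) * (β - h / N)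
        = y * (((σ h : ℕ) + t) / N) + ((y * ((b - h) / (N : ℤ)) : ℤ) : ℝ) := by
      push_cast
      field_simp
      linear_combination (y : ℝ) * hβ - (y : ℝ) * hdR
    rw [this, addExp_add, addExp_int, mul_one]
  rw [sum_congr rfl hterm, sum_range_comp_of_injOn σ hmaps hinj]
  have hbound : ∀ k ∈ range N,
      φ k ≤ 2 * N * (1 / ((k : ℝ) + 1)) + 2 * N * (1 / ((N - 1 - k : ℕ) + 1)) := by
    intro k hk
    have hk : k < N := mem_range.1 hk
    have hcN : (((N - 1 - k : ℕ) : ℝ) + 1) = N - k := by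
      have : N - 1 - k + 1 + k = N := by omega
      have : (((N - 1 - k : ℕ) : ℝ) + 1 + k) = N := by exact_mod_cast this
      linarith
    rw [hcN]
    have hkN : (k : ℝ) + 1 ≤ N := by exact_mod_cast hk
    have hk0 : (0 : ℝ) ≤ k := Nat.cast_nonneg k
    have htriv : φ k ≤ N := by
      refine (norm_sum_le _ _).trans ?_
      simp only [norm_addExp, sum_const, card_range, nsmul_eq_mul, mul_one]
      exact_mod_cast hK
    have p1 : 0 ≤ 2 * (N : ℝ) * (1 / ((k : ℝ) + 1)) := by positivity
    have p2 : 0 ≤ 2 * (N : ℝ) * (1 / ((N : ℝ) - k)) := by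
      have : 0 < (N : ℝ) - k := by linarith
      positivity
    by_cases hk1 : k = 0
    · subst hk1
      norm_num at p2 ⊢
      nlinarith
    by_cases hk2 : k + 1 = N
    · have : (N : ℝ) - k = 1 := by rw [← hk2]; push_cast; ring
      rw [this]
      linarith
    have hk1' : (1 : ℝ) ≤ k := by exact_mod_cast Nat.one_le_iff_ne_zero.2 hk1
    have hk2' : (k : ℝ) + 2 ≤ N := by
      have : k + 2 ≤ N := by omega
      exact_mod_cast this
    have hγ0 : 0 < (k + t) / N := by positivity
    have hγ1 : (k + t) / N < 1 := by
      rw [div_lt_one hNR]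
      linarith
    refine (norm_sum_addExp_le K hγ0 hγ1).trans ?_
    have e1 : 1 / (2 * ((k + t) / N)) ≤ 2 * N * (1 / ((k : ℝ) + 1)) := by
      rw [show 1 / (2 * ((k + t) / N)) = N / (2 * (k + t)) by field_simp, mul_one_div]
      apply div_le_div₀ <;> linarith
    have e2 : 1 / (2 * (1 - (k + t) / N)) ≤ 2 * N * (1 / ((N : ℝ) - k)) := by
      have hpos : 0 < (N : ℝ) - (k + t) := by linarith
      rw [show 1 / (2 * (1 - (k + t) / N)) = N / (2 * (N - (k + t))) by field_simp, mul_one_div]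
      apply div_le_div₀ <;> linarith
    linarith
  refine (sum_le_sum hbound).trans ?_
  rw [sum_add_distrib, ← mul_sum, ← mul_sum,
    sum_range_reflect (fun j => 1 / ((j : ℝ) + 1)) N]
  have hharm : ∑ j ∈ range N, 1 / ((j : ℝ) + 1) ≤ 1 + r := by
    have h := harmonic_le_one_add_log N
    have h2 : ((harmonic N : ℚ) : ℝ) = ∑ j ∈ range N, 1 / ((j : ℝ) + 1) := by
      simp [harmonic]
    have h3 : Real.log N ≤ r := by
      rw [← hcast, Real.log_pow]
      have := Real.log_two_lt_d9
      have hr : (0 : ℝ) ≤ r := Nat.cast_nonneg r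
      nlinarith
    linarith
  nlinarith

/-- Discrete Fourier expansion of `y ↦ 1_{y < K} e(β y)` on `{0, …, 2 ^ r - 1}`, with a
logarithmic bound for the sum of the coefficients. -/
lemma exists_fourier_expansion (r K : ℕ) (hK : K ≤ 2 ^ r) (β : ℝ) :
    ∃ c : ℕ → ℂ, ∑ h ∈ range (2 ^ r), ‖c h‖ ≤ 4 * (1 + r) ∧
      ∀ y : ℕ, y < 2 ^ r → (if y < K then addExp (y * β) else 0)
        = ∑ h ∈ range (2 ^ r), c h * addExp (h * y / 2 ^ r) := by
  have h2 : (0 : ℝ) < 2 ^ r := by positivity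
  refine ⟨fun h => ((2 ^ r : ℝ)⁻¹ : ℝ) * ∑ y ∈ range K, addExp (y * (β - h / 2 ^ r)), ?_, ?_⟩
  · simp only [norm_mul, Complex.norm_real, Real.norm_eq_abs, abs_of_pos (inv_pos.2 h2)]
    rw [← mul_sum, inv_mul_le_iff₀ h2]
    exact sum_norm_kernel_le r K hK β
  · intro y hy
    have horth : ∀ z : ℕ, z < 2 ^ r → ∑ h ∈ range (2 ^ r), addExp (h * (((y : ℝ) - z) / 2 ^ r))
        = if z = y then (2 ^ r : ℂ) else 0 := by
      intro z hz
      simp only [addExp_nat_mul]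
      split_ifs with hzy
      · simp [hzy, addExp_zero]
      · have hne : addExp (((y : ℝ) - z) / 2 ^ r) ≠ 1 := by
          intro h
          obtain ⟨k, hk⟩ := addExp_eq_one_iff.1 h
          rw [div_eq_iff h2.ne'] at hk
          have hk' : (y : ℤ) - z = k * 2 ^ r := by exact_mod_cast hk
          have h0 := Int.eq_zero_of_abs_lt_dvd (m := 2 ^ r) (x := (y : ℤ) - z)
            ⟨k, by rw [hk']; ring⟩ (by
            rw [abs_lt]
            have : (y : ℤ) < 2 ^ r := by exact_mod_cast hy
            have : (z : ℤ) < 2 ^ r := by exact_mod_cast hz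
            omega)
          omega
        rw [geom_sum_eq hne, ← addExp_nat_mul]
        have : ((2 ^ r : ℕ) : ℝ) * (((y : ℝ) - z) / 2 ^ r) = (((y : ℤ) - z : ℤ) : ℝ) := by
          push_cast
          field_simp
        rw [this, addExp_int]
        simp
    have key : ∑ h ∈ range (2 ^ r), (((2 ^ r : ℝ)⁻¹ : ℝ) * ∑ z ∈ range K,
          addExp (z * (β - h / 2 ^ r))) * addExp (h * y / 2 ^ r)
        = ∑ z ∈ range K, ((2 ^ r : ℂ)⁻¹ * addExp (z * β))
          * ∑ h ∈ range (2 ^ r), addExp (h * (((y : ℝ) - z) / 2 ^ r)) := by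
      simp only [mul_sum, sum_mul]
      rw [sum_comm]
      refine sum_congr rfl fun z _ => sum_congr rfl fun h _ => ?_
      have : (z : ℝ) * (β - h / 2 ^ r) + h * y / 2 ^ r = z * β + h * (((y : ℝ) - z) / 2 ^ r) := by
        ring
      have h' := congrArg addExp this
      rw [addExp_add, addExp_add] at h'
      push_cast
      rw [mul_assoc, mul_assoc, h']
    rw [key, sum_congr rfl fun z hz => by rw [horth z ((mem_range.1 hz).trans_le hK)]]
    simp only [mul_ite, mul_zero, sum_ite_eq', mem_range]
    split_ifs
    · field_simp
    · rfl

lemma walsh_insert {A : Finset ℕ} {j : ℕ} (hj : j ∉ A) (v : ℕ) :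
    walsh (insert j A) v = (-1) ^ ((v / 2 ^ j) % 2) * walsh A v := by
  rw [walsh, walsh, sum_insert hj, pow_add]

lemma walsh_union {A B : Finset ℕ} (h : Disjoint A B) (v : ℕ) :
    walsh (A ∪ B) v = walsh A v * walsh B v := by
  rw [walsh, walsh, walsh, sum_union h, pow_add]

lemma abs_walsh_s16 (A : Finset ℕ) (v : ℕ) : |walsh A v| = 1 := by
  simp [walsh, abs_pow]

lemma walsh_add_mul_two_pow {A : Finset ℕ} {L : ℕ} (hA : A ⊆ range L) (v q : ℕ) :
    walsh A (v + 2 ^ L * q) = walsh A v := by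
  unfold walsh
  congr 1
  refine sum_congr rfl fun j hj => ?_
  have hj : j < L := mem_range.1 (hA hj)
  obtain ⟨d, rfl⟩ := Nat.exists_eq_add_of_lt hj
  have : v + 2 ^ (j + d + 1) * q = v + 2 ^ j * (2 * (2 ^ d * q)) := by ring
  rw [this, Nat.add_mul_div_left _ _ (Nat.two_pow_pos j), Nat.add_mul_mod_self_left]

lemma walsh_mod_two_pow {A : Finset ℕ} {L : ℕ} (hA : A ⊆ range L) (v : ℕ) :
    walsh A (v % 2 ^ L) = walsh A v := by
  conv_rhs => rw [← Nat.mod_add_div v (2 ^ L)]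
  rw [walsh_add_mul_two_pow hA]

/-- Multiplying the argument by `2 ^ a` shifts the index set of a Walsh function down by `a`. -/
lemma walsh_two_pow_mul (A : Finset ℕ) (a v : ℕ) :
    walsh A (2 ^ a * v) = walsh ((A.filter (a ≤ ·)).image (· - a)) v := by
  unfold walsh
  congr 1
  rw [sum_image, sum_filter]
  · refine sum_congr rfl fun j _ => ?_
    split_ifs with h
    · obtain ⟨d, rfl⟩ := Nat.exists_eq_add_of_le h
      rw [pow_add, Nat.mul_div_mul_left _ _ (Nat.two_pow_pos a), Nat.add_sub_cancel_left]
    · obtain ⟨d, rfl⟩ := Nat.exists_eq_add_of_lt (not_le.1 h)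
      rw [show 2 ^ (j + d + 1) * v = 2 ^ j * (2 * (2 ^ d * v)) by ring,
        Nat.mul_div_cancel_left _ (Nat.two_pow_pos j), Nat.mul_mod_right]
  · intro x hx y hy h
    have hx := (mem_filter.1 hx).2
    have hy := (mem_filter.1 hy).2
    simp only at h
    omega

lemma card_image_sub_filter (A : Finset ℕ) (a : ℕ) :
    A.card ≤ ((A.filter (a ≤ ·)).image (· - a)).card + a := by
  rw [card_image_of_injOn]
  · have h := card_filter_add_card_filter_not (s := A) (a ≤ ·)
    have h2 : (A.filter (¬ a ≤ ·)).card ≤ a := by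
      calc (A.filter (¬ a ≤ ·)).card ≤ (range a).card := by
            refine card_le_card fun x hx => ?_
            simpa using (mem_filter.1 hx).2
        _ = a := card_range a
    omega
  · intro x hx y hy h
    have hx := (mem_filter.1 hx).2
    have hy := (mem_filter.1 hy).2
    simp only at h
    omega

/-- The exponential sum of a Walsh function over `{0, …, 2 ^ L - 1}` factorises over digits. -/
lemma sum_walsh_filter_succ (A : Finset ℕ) (L : ℕ) (θ : ℝ) :
    ∑ v ∈ range (2 ^ (L + 1)), (walsh (A.filter (· < L + 1)) v : ℂ) * addExp (v * θ)
      = (∑ v ∈ range (2 ^ L), (walsh (A.filter (· < L)) v : ℂ) * addExp (v * θ))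
        * (1 + ((if L ∈ A then -1 else 1 : ℝ) : ℂ) * addExp (2 ^ L * θ)) := by
  have hsub : A.filter (· < L) ⊆ range L := fun x hx => mem_range.2 (mem_filter.1 hx).2
  have hnot : L ∉ A.filter (· < L) := by simp
  have hw : ∀ v, walsh (A.filter (· < L + 1)) v
      = (if L ∈ A then (-1) ^ ((v / 2 ^ L) % 2) else 1) * walsh (A.filter (· < L)) v := by
    intro v
    split_ifs with h
    · rw [← walsh_insert hnot]
      congr 1
      ext x
      simp only [mem_filter, mem_insert]
      constructor
      · rintro ⟨h1, h2⟩
        rcases Nat.lt_succ_iff_lt_or_eq.1 h2 with h3 | h3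
        · exact Or.inr ⟨h1, h3⟩
        · exact Or.inl h3
      · rintro (rfl | ⟨h1, h2⟩)
        · exact ⟨h, by omega⟩
        · exact ⟨h1, by omega⟩
    · rw [one_mul]
      congr 1
      ext x
      simp only [mem_filter, and_congr_right_iff]
      intro hx
      have : x ≠ L := fun e => h (e ▸ hx)
      omega
  rw [pow_succ, mul_two, sum_range_add, mul_add, mul_one, sum_mul]
  congr 1
  · refine sum_congr rfl fun v hv => ?_
    rw [hw, Nat.div_eq_of_lt (mem_range.1 hv)]
    simp
  · refine sum_congr rfl fun v hv => ?_
    have h1 := walsh_add_mul_two_pow hsub v 1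
    have h2 : (2 ^ L + v) / 2 ^ L = 1 := by
      rw [Nat.add_div_left _ (Nat.two_pow_pos L), Nat.div_eq_of_lt (mem_range.1 hv)]
    have h3 : (((2 ^ L + v : ℕ)) : ℝ) * θ = v * θ + 2 ^ L * θ := by push_cast; ring
    rw [mul_one, add_comm v] at h1
    rw [hw, h1, h2, h3, addExp_add]
    split_ifs <;> push_cast <;> ring

/-- Two consecutive digit factors cannot both be close to `1` when the second one belongs to the
index set. -/
lemma norm_sum_walsh_filter_pow_four_le (A : Finset ℕ) (L : ℕ) (θ : ℝ) :
    ‖∑ v ∈ range (2 ^ (L + 1)), (walsh (A.filter (· < L + 1)) v : ℂ) * addExp (v * θ)‖ ^ 4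
      ≤ 16 ^ (L + 1) * (16 / 27 : ℝ) ^ ((A.filter (· < L + 1)).erase 0).card
        * ((1 + (if L ∈ A then -1 else 1) * Real.cos (2 * Real.pi * (2 ^ L * θ))) / 2) := by
  have hsq : ∀ L, ‖1 + ((if L ∈ A then -1 else 1 : ℝ) : ℂ) * addExp (2 ^ L * θ)‖ ^ 2
      = 4 * ((1 + (if L ∈ A then -1 else 1) * Real.cos (2 * Real.pi * (2 ^ L * θ))) / 2) := by
    intro L
    rw [normSq_one_add_mul_addExp _ _ (by split_ifs <;> norm_num)]
    ring
  set g : ℕ → ℝ := fun L =>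
    (1 + (if L ∈ A then -1 else 1) * Real.cos (2 * Real.pi * (2 ^ L * θ))) / 2 with hg
  have hg0 : ∀ L, 0 ≤ g L := by
    intro L
    have h1 := Real.neg_one_le_cos (2 * Real.pi * (2 ^ L * θ))
    have h2 := Real.cos_le_one (2 * Real.pi * (2 ^ L * θ))
    simp only [hg]
    split_ifs <;> linarith
  have hg1 : ∀ L, g L ≤ 1 := by
    intro L
    have h1 := Real.neg_one_le_cos (2 * Real.pi * (2 ^ L * θ))
    have h2 := Real.cos_le_one (2 * Real.pi * (2 ^ L * θ))
    simp only [hg]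
    split_ifs <;> linarith
  have hgg : ∀ L, L + 1 ∈ A → g L * g (L + 1) ≤ 16 / 27 := by
    intro L hL
    have h1 := Real.neg_one_le_cos (2 * Real.pi * (2 ^ L * θ))
    have h2 := Real.cos_le_one (2 * Real.pi * (2 ^ L * θ))
    have h3 : Real.cos (2 * Real.pi * (2 ^ (L + 1) * θ))
        = 2 * Real.cos (2 * Real.pi * (2 ^ L * θ)) ^ 2 - 1 := by
      rw [← Real.cos_two_mul]
      congr 1
      ring
    simp only [hg, if_pos hL, h3]
    set x := Real.cos (2 * Real.pi * (2 ^ L * θ))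
    split_ifs
    · nlinarith [mul_nonneg (sq_nonneg (x + 1 / 3)) (show 0 ≤ 5 / 3 + x by linarith)]
    · nlinarith [mul_nonneg (sq_nonneg (x - 1 / 3)) (show 0 ≤ 5 / 3 - x by linarith)]
  induction L with
  | zero =>
    have h0 : (A.filter (· < 0 + 1)).erase 0 = ∅ := by
      ext x
      simp only [mem_erase, mem_filter, notMem_empty, iff_false]
      rintro ⟨h1, -, h2⟩
      omega
    have h1 : A.filter (· < 0) = ∅ := by simp
    rw [sum_walsh_filter_succ, h0, h1, norm_mul, mul_pow]
    have : ‖1 + ((if 0 ∈ A then -1 else 1 : ℝ) : ℂ) * addExp (2 ^ 0 * θ)‖ ^ 4 = (4 * g 0) ^ 2 := by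
      rw [← hsq 0]
      ring
    have h2 : ∑ v ∈ range (2 ^ 0), (walsh ∅ v : ℂ) * addExp (v * θ) = 1 := by
      simp [walsh, addExp_zero]
    rw [this, h2, card_empty, norm_one, one_pow, one_mul, zero_add, pow_one, pow_zero, mul_one]
    change _ ≤ 16 * g 0
    nlinarith [hg0 0, hg1 0]
  | succ L ih =>
    rw [sum_walsh_filter_succ, norm_mul, mul_pow]
    have : ‖1 + ((if L + 1 ∈ A then -1 else 1 : ℝ) : ℂ) * addExp (2 ^ (L + 1) * θ)‖ ^ 4
        = 16 * g (L + 1) ^ 2 := by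
      rw [show 16 * g (L + 1) ^ 2 = (4 * g (L + 1)) ^ 2 by ring, ← hsq (L + 1)]
      ring
    rw [this]
    change _ ≤ 16 ^ (L + 1) * (16 / 27 : ℝ) ^ ((A.filter (· < L + 1)).erase 0).card * g L at ih
    change _ ≤ _ * g (L + 1)
    refine (mul_le_mul_of_nonneg_right ih (by positivity)).trans ?_
    have hcard : (16 / 27 : ℝ) ^ ((A.filter (· < L + 1)).erase 0).card * (g L * g (L + 1))
        ≤ (16 / 27 : ℝ) ^ ((A.filter (· < L + 1 + 1)).erase 0).card := by
      by_cases hL : L + 1 ∈ A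
      · have : (A.filter (· < L + 1 + 1)).erase 0
            = insert (L + 1) ((A.filter (· < L + 1)).erase 0) := by
          ext x
          simp only [mem_erase, mem_filter, mem_insert]
          constructor
          · rintro ⟨h1, h2, h3⟩
            by_cases h : x = L + 1
            · exact Or.inl h
            · exact Or.inr ⟨h1, h2, by omega⟩
          · rintro (rfl | ⟨h1, h2, h3⟩)
            · exact ⟨by omega, hL, by omega⟩
            · exact ⟨h1, h2, by omega⟩
        rw [this, card_insert_of_notMem (by simp), pow_succ]
        exact mul_le_mul_of_nonneg_left (hgg L hL) (by positivity)
      · have : A.filter (· < L + 1 + 1) = A.filter (· < L + 1) := by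
          ext x
          simp only [mem_filter, and_congr_right_iff]
          intro hx
          have : x ≠ L + 1 := fun e => hL (e ▸ hx)
          omega
        rw [this]
        refine mul_le_of_le_one_right (by positivity) ?_
        exact mul_le_one₀ (hg1 L) (hg0 _) (hg1 _)
    calc 16 ^ (L + 1) * (16 / 27 : ℝ) ^ ((A.filter (· < L + 1)).erase 0).card * g L
          * (16 * g (L + 1) ^ 2)
        = 16 ^ (L + 1 + 1) * g (L + 1) * ((16 / 27 : ℝ) ^ ((A.filter (· < L + 1)).erase 0).card
          * (g L * g (L + 1))) := by ring
      _ ≤ 16 ^ (L + 1 + 1) * g (L + 1)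
          * (16 / 27 : ℝ) ^ ((A.filter (· < L + 1 + 1)).erase 0).card :=
        mul_le_mul_of_nonneg_left hcard (mul_nonneg (by positivity) (hg0 _))
      _ = _ := by ring

/-- Sup-norm bound for the Fourier transform of a Walsh function. -/
lemma norm_sum_walsh_le {A : Finset ℕ} {L : ℕ} (hA : A ⊆ range L) (θ : ℝ) :
    ‖∑ v ∈ range (2 ^ L), (walsh A v : ℂ) * addExp (v * θ)‖
      ≤ 2 ^ L * (2 : ℝ) ^ (-((A.card : ℝ) - 1) / 8) := by
  rcases L with _ | L
  · have : A = ∅ := by simpa using hA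
    subst this
    simp only [pow_zero, range_one, sum_singleton, walsh, sum_empty, Nat.cast_zero, zero_mul,
      addExp_zero, Complex.ofReal_one, norm_one, one_mul, card_empty]
    exact Real.one_le_rpow (by norm_num) (by norm_num)
  have hf : A.filter (· < L + 1) = A := filter_true_of_mem fun x hx => mem_range.1 (hA hx)
  have h := norm_sum_walsh_filter_pow_four_le A L θ
  rw [hf] at h
  set D := ‖∑ v ∈ range (2 ^ (L + 1)), (walsh A v : ℂ) * addExp (v * θ)‖
  have hD0 : 0 ≤ D := norm_nonneg _
  have hgle : (1 + (if L ∈ A then -1 else 1) * Real.cos (2 * Real.pi * (2 ^ L * θ))) / 2 ≤ 1 := by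
    have h1 := Real.neg_one_le_cos (2 * Real.pi * (2 ^ L * θ))
    have h2 := Real.cos_le_one (2 * Real.pi * (2 ^ L * θ))
    split_ifs <;> linarith
  have h4 : D ^ 4 ≤ 16 ^ (L + 1) * (16 / 27 : ℝ) ^ (A.erase 0).card :=
    h.trans (mul_le_of_le_one_right (by positivity) hgle)
  have h8 : D ^ 8 ≤ 256 ^ (L + 1) * (1 / 2 : ℝ) ^ (A.erase 0).card := by
    calc D ^ 8 = (D ^ 4) ^ 2 := by ring
      _ ≤ (16 ^ (L + 1) * (16 / 27 : ℝ) ^ (A.erase 0).card) ^ 2 := by gcongr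
      _ = 256 ^ (L + 1) * ((16 / 27 : ℝ) ^ 2) ^ (A.erase 0).card := by
        rw [mul_pow, ← pow_mul, mul_comm (L + 1), pow_mul, ← pow_mul _ (A.erase 0).card,
          mul_comm _ 2, pow_mul _ 2 (A.erase 0).card]
        norm_num
      _ ≤ _ := by
        gcongr
        norm_num
  have hc : (A.card : ℝ) - 1 ≤ ((A.erase 0).card : ℕ) := by
    have := pred_card_le_card_erase (s := A) (a := 0)
    have : A.card ≤ (A.erase 0).card + 1 := by omega
    have : (A.card : ℝ) ≤ (A.erase 0).card + 1 := by exact_mod_cast this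
    linarith
  refine le_of_pow_le_pow_left₀ (n := 8) (by norm_num) (by positivity) (h8.trans ?_)
  rw [mul_pow, ← pow_mul, mul_comm (L + 1), pow_mul, ← Real.rpow_natCast (_ ^ _ : ℝ) 8,
    ← Real.rpow_mul (by norm_num)]
  norm_num only
  gcongr
  rw [one_div, inv_pow, ← Real.rpow_natCast, ← Real.rpow_neg (by norm_num)]
  apply Real.rpow_le_rpow_of_exponent_le (by norm_num)
  linarith

lemma addExp_div_eq_of_modEq {N a b : ℕ} (hN : 0 < N) (h : a ≡ b [MOD N]) :
    addExp (a / N) = addExp (b / N) := by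
  obtain ⟨k, hk⟩ := (Nat.modEq_iff_dvd.1 h : (N : ℤ) ∣ b - a)
  have hkR : (b : ℝ) - a = N * k := by exact_mod_cast hk
  have hNR : (N : ℝ) ≠ 0 := by exact_mod_cast hN.ne'
  have : (b : ℝ) / N = a / N + (k : ℤ) := by
    field_simp
    linarith
  rw [this, addExp_add, addExp_int, mul_one]

lemma norm_sum_walsh_odd_mul_le {A : Finset ℕ} {L x : ℕ} (hA : A ⊆ range L) (hx : Odd x)
    (β : ℝ) :
    ‖∑ z ∈ range (2 ^ L), (walsh A (x * z) : ℂ) * addExp (z * β)‖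
      ≤ 4 * (1 + L) * (2 ^ L * (2 : ℝ) ^ (-((A.card : ℝ) - 1) / 8)) := by
  obtain ⟨c, hc, hexp⟩ := exists_fourier_expansion L (2 ^ L) le_rfl β
  have hpos : 0 < 2 ^ L := Nat.two_pow_pos L
  have hcop : Nat.Coprime x (2 ^ L) := Nat.Coprime.pow_right _ (Nat.coprime_two_right.2 hx)
  obtain ⟨u, hu⟩ : ∃ u, u * x ≡ 1 [MOD 2 ^ L] := by
    obtain ⟨u, -, hu⟩ := Nat.exists_mul_mod_eq_of_coprime 1 hcop hpos.ne'
    exact ⟨u, by rw [mul_comm]; exact hu⟩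
  have hswap : ∑ z ∈ range (2 ^ L), (walsh A (x * z) : ℂ) * addExp (z * β)
      = ∑ h ∈ range (2 ^ L), c h *
        ∑ z ∈ range (2 ^ L), (walsh A (x * z) : ℂ) * addExp (h * z / 2 ^ L) := by
    simp only [mul_sum]
    rw [sum_comm]
    refine sum_congr rfl fun z hz => ?_
    have := hexp z (mem_range.1 hz)
    rw [if_pos (mem_range.1 hz)] at this
    rw [this, mul_sum]
    refine sum_congr rfl fun h _ => ?_
    ring
  have hinner : ∀ h : ℕ, ‖∑ z ∈ range (2 ^ L), (walsh A (x * z) : ℂ) * addExp (h * z / 2 ^ L)‖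
      ≤ 2 ^ L * (2 : ℝ) ^ (-((A.card : ℝ) - 1) / 8) := by
    intro h
    refine le_trans (le_of_eq ?_) (norm_sum_walsh_le hA (u * h / 2 ^ L))
    congr 1
    rw [← sum_range_comp_of_injOn (fun z => x * z % 2 ^ L) (fun _ _ => Nat.mod_lt _ hpos) ?_
      fun v => (walsh A v : ℂ) * addExp (v * (u * h / 2 ^ L))]
    · refine sum_congr rfl fun z _ => ?_
      rw [walsh_mod_two_pow hA]
      congr 1
      have hmod : h * z ≡ (x * z % 2 ^ L) * (u * h) [MOD 2 ^ L] := by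
        calc h * z = 1 * (h * z) := (one_mul _).symm
          _ ≡ u * x * (h * z) [MOD 2 ^ L] := hu.symm.mul_right _
          _ = x * z * (u * h) := by ring
          _ ≡ (x * z % 2 ^ L) * (u * h) [MOD 2 ^ L] := (Nat.mod_modEq _ _).symm.mul_right _
      have := addExp_div_eq_of_modEq hpos hmod
      push_cast at this ⊢
      rw [this]
      congr 1
      ring
    · intro k hk l hl hkl
      have h1 : x * k ≡ x * l [MOD 2 ^ L] := hkl
      have h2 : k ≡ l [MOD 2 ^ L] := Nat.ModEq.cancel_left_of_coprime hcop.symm h1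
      exact h2.eq_of_lt_of_lt hk hl
  rw [hswap]
  refine (norm_sum_le _ _).trans ?_
  simp only [norm_mul]
  calc ∑ h ∈ range (2 ^ L), ‖c h‖ *
        ‖∑ z ∈ range (2 ^ L), (walsh A (x * z) : ℂ) * addExp (h * z / 2 ^ L)‖
      ≤ ∑ h ∈ range (2 ^ L), ‖c h‖ * (2 ^ L * (2 : ℝ) ^ (-((A.card : ℝ) - 1) / 8)) :=
        sum_le_sum fun h _ => mul_le_mul_of_nonneg_left (hinner h) (norm_nonneg _)
    _ ≤ _ := by
        rw [← sum_mul]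
        exact mul_le_mul_of_nonneg_right hc (by positivity)

lemma norm_sum_blocks_le (F : ℕ → ℂ) (N : ℕ) (E : ℝ)
    (h : ∀ q, ‖∑ z ∈ range N, F (N * q + z)‖ ≤ E) (q Q : ℕ) :
    ‖∑ y ∈ range (N * Q), F (N * q + y)‖ ≤ Q * E := by
  induction Q with
  | zero => simp
  | succ Q ih =>
    rw [mul_add, mul_one, sum_range_add]
    refine (norm_add_le _ _).trans ?_
    have h1 := h (q + Q)
    simp only [mul_add, add_assoc] at h1
    push_cast
    linarith

/-- A Walsh function supported on low digits, evaluated along multiples of `2 ^ a * x` with `x` odd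
and twisted by an arbitrary linear phase, has small sums over long intervals. -/
lemma norm_sum_low_le {A : Finset ℕ} {L a x : ℕ} (hA : A ⊆ range L) (hx : Odd x)
    (β : ℝ) (q Q : ℕ) :
    ‖∑ y ∈ range (2 ^ L * Q), (walsh A (2 ^ a * x * (2 ^ L * q + y)) : ℂ)
        * addExp ((2 ^ L * q + y : ℕ) * β)‖
      ≤ Q * (4 * (1 + L) * (2 ^ L * (2 : ℝ) ^ (-((A.card : ℝ) - a - 1) / 8))) := by
  set A' := (A.filter (a ≤ ·)).image (· - a) with hA'
  have hA'L : A' ⊆ range L := by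
    intro j hj
    obtain ⟨i, hi, rfl⟩ := mem_image.1 hj
    have := mem_range.1 (hA (mem_filter.1 hi).1)
    exact mem_range.2 (by omega)
  have hcard : (A.card : ℝ) ≤ A'.card + a := by exact_mod_cast card_image_sub_filter A a
  refine norm_sum_blocks_le (fun y => (walsh A (2 ^ a * x * y) : ℂ) * addExp (y * β)) _ _ ?_ q Q
  intro q
  have hterm : ∀ z, (walsh A (2 ^ a * x * (2 ^ L * q + z)) : ℂ) * addExp ((2 ^ L * q + z : ℕ) * β)
      = addExp ((2 ^ L * q : ℕ) * β) * ((walsh A' (x * z) : ℂ) * addExp (z * β)) := by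
    intro z
    rw [mul_assoc, walsh_two_pow_mul, ← hA',
      show x * (2 ^ L * q + z) = x * z + 2 ^ L * (x * q) by ring, walsh_add_mul_two_pow hA'L,
      Nat.cast_add, add_mul, addExp_add]
    ring
  simp only [hterm]
  rw [← mul_sum, norm_mul, norm_addExp, one_mul]
  refine (norm_sum_walsh_odd_mul_le hA'L hx β).trans ?_
  gcongr
  · norm_num
  · linarith

/-- Fourier expansion of a single binary digit. -/
lemma exists_digit_expansion (j : ℕ) :
    ∃ d : ℕ → ℂ, ∑ h ∈ range (2 ^ (j + 1)), ‖d h‖ ≤ 8 * j + 17 ∧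
      ∀ v : ℕ, (-1 : ℂ) ^ ((v / 2 ^ j) % 2)
        = ∑ h ∈ range (2 ^ (j + 1)), d h * addExp (v * (h / 2 ^ (j + 1))) := by
  obtain ⟨c, hc, hexp⟩ := exists_fourier_expansion (j + 1) (2 ^ j)
    (Nat.pow_le_pow_right (by norm_num) (by omega)) 0
  have hpos : 0 < 2 ^ (j + 1) := Nat.two_pow_pos _
  refine ⟨fun h => 2 * c h - if h = 0 then 1 else 0, ?_, fun v => ?_⟩
  · calc ∑ h ∈ range (2 ^ (j + 1)), ‖2 * c h - if h = 0 then 1 else 0‖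
        ≤ ∑ h ∈ range (2 ^ (j + 1)), (2 * ‖c h‖ + if h = 0 then 1 else 0) := by
          refine sum_le_sum fun h _ => (norm_sub_le _ _).trans ?_
          rw [norm_mul, Complex.norm_ofNat]
          split_ifs <;> simp
      _ ≤ _ := by
          rw [sum_add_distrib, ← mul_sum, sum_ite_eq', if_pos (mem_range.2 hpos)]
          push_cast at hc
          linarith
  · simp only [sub_mul, sum_sub_distrib, ite_mul, one_mul, zero_mul, sum_ite_eq',
      if_pos (mem_range.2 hpos), Nat.cast_zero, zero_div, mul_zero, addExp_zero]
    have h := hexp (v % 2 ^ (j + 1)) (Nat.mod_lt _ hpos)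
    simp only [mul_zero, addExp_zero] at h
    have hterm : ∀ k : ℕ, addExp (k * ((v % 2 ^ (j + 1) : ℕ) : ℝ) / 2 ^ (j + 1))
        = addExp (v * (k / 2 ^ (j + 1))) := by
      intro k
      have := addExp_div_eq_of_modEq hpos ((Nat.mod_modEq v (2 ^ (j + 1))).mul_left k)
      push_cast at this
      rw [this]
      congr 1
      ring
    simp only [hterm] at h
    simp only [mul_assoc, ← mul_sum, ← h]
    have hdig : v / 2 ^ j % 2 = (v % 2 ^ (j + 1)) / 2 ^ j := by
      rw [pow_succ, Nat.mod_mul_right_div_self]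
    rw [hdig]
    split_ifs with hlt
    · rw [Nat.div_eq_of_lt hlt]
      norm_num
    · have : v % 2 ^ (j + 1) / 2 ^ j = 1 := by
        apply Nat.div_eq_of_lt_le
        · simpa using hlt
        · have := Nat.mod_lt v hpos
          have := pow_succ 2 j
          omega
      rw [this]
      norm_num

/-- Multiplying by a Walsh function with few digits costs only a small factor. -/
lemma norm_sum_walsh_mul_le {lam : ℕ} (Y : Finset ℕ) (g : ℕ → ℂ) (x : ℕ) {E : ℝ}
    (hE : ∀ β : ℝ, ‖∑ y ∈ Y, g y * addExp (y * β)‖ ≤ E) (B : Finset ℕ) (hB : B ⊆ range lam)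
    (β : ℝ) :
    ‖∑ y ∈ Y, (walsh B (x * y) : ℂ) * (g y * addExp (y * β))‖ ≤ (8 * lam + 9) ^ B.card * E := by
  have hE0 : 0 ≤ E := (norm_nonneg _).trans (hE 0)
  induction B using Finset.induction_on generalizing β with
  | empty => simpa [walsh] using hE β
  | insert j B hj ih =>
    obtain ⟨d, hd, hexp⟩ := exists_digit_expansion j
    have hjl : j + 1 ≤ lam := mem_range.1 (hB (mem_insert_self j B))
    have hjl : (j : ℝ) + 1 ≤ lam := by exact_mod_cast hjl
    have ih := ih ((subset_insert j B).trans hB)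
    have hswap : ∑ y ∈ Y, (walsh (insert j B) (x * y) : ℂ) * (g y * addExp (y * β))
        = ∑ h ∈ range (2 ^ (j + 1)), d h * ∑ y ∈ Y, (walsh B (x * y) : ℂ) *
          (g y * addExp (y * (β + x * (h / 2 ^ (j + 1))))) := by
      simp only [mul_sum]
      rw [sum_comm]
      refine sum_congr rfl fun y _ => ?_
      rw [walsh_insert hj]
      push_cast
      rw [hexp, sum_mul, sum_mul]
      refine sum_congr rfl fun h _ => ?_
      rw [show (y : ℝ) * (β + x * (h / 2 ^ (j + 1)))
        = y * β + (x * y : ℕ) * (h / 2 ^ (j + 1)) by push_cast; ring, addExp_add]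
      ring
    rw [hswap, card_insert_of_notMem hj, pow_succ]
    refine (norm_sum_le _ _).trans ?_
    simp only [norm_mul]
    calc _ ≤ ∑ h ∈ range (2 ^ (j + 1)), ‖d h‖ * ((8 * lam + 9) ^ B.card * E) :=
          sum_le_sum fun h _ => mul_le_mul_of_nonneg_left (ih _) (norm_nonneg _)
      _ ≤ (8 * lam + 9) * ((8 * lam + 9) ^ B.card * E) := by
          rw [← sum_mul]
          refine mul_le_mul_of_nonneg_right (hd.trans ?_) (by positivity)
          linarith
      _ = _ := by ring

lemma card_filter_two_pow_dvd_mul_le (m t : ℕ) :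
    ((Ico (2 ^ m) (2 ^ (m + 1))).filter (2 ^ t ∣ ·)).card * 2 ^ t ≤ 2 ^ m := by
  rcases le_or_gt t m with h | h
  · obtain ⟨d, rfl⟩ := Nat.exists_eq_add_of_le h
    have hcard : ((Ico (2 ^ (t + d)) (2 ^ (t + d + 1))).filter (2 ^ t ∣ ·)).card
        ≤ (Ico (2 ^ d) (2 ^ (d + 1))).card := by
      refine (card_le_card (t := (Ico (2 ^ d) (2 ^ (d + 1))).image (2 ^ t * ·)) ?_).trans
        card_image_le
      intro x hx
      obtain ⟨hx1, y, rfl⟩ := mem_filter.1 hx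
      rw [mem_Ico, add_assoc, pow_add, pow_add] at hx1
      refine mem_image_of_mem _ (mem_Ico.2 ⟨?_, ?_⟩)
      · exact Nat.le_of_mul_le_mul_left hx1.1 (Nat.two_pow_pos t)
      · exact Nat.lt_of_mul_lt_mul_left hx1.2
    rw [Nat.card_Ico, pow_succ 2 d] at hcard
    calc _ ≤ 2 ^ d * 2 ^ t := Nat.mul_le_mul_right _ (by omega)
      _ = 2 ^ (t + d) := by rw [pow_add, mul_comm]
  · have : (Ico (2 ^ m) (2 ^ (m + 1))).filter (2 ^ t ∣ ·) = ∅ := by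
      refine filter_false_of_mem fun x hx hd => ?_
      have hx := mem_Ico.1 hx
      have h1 := Nat.le_of_dvd ((Nat.two_pow_pos m).trans_le hx.1) hd
      have h2 : 2 ^ (m + 1) ≤ 2 ^ t := Nat.pow_le_pow_right (by norm_num) h
      omega
    simp [this]

lemma abs_sum_walsh_le {lam m n : ℕ} (hmn : m + n = lam) (hm : 2 * m < lam) {S : Finset ℕ}
    (hS : S ⊆ range lam) {x t : ℕ} (hx0 : x ≠ 0)
    (ht : t = (S ∩ Ico 0 (lam - 2 * m)).card / 2) (hx : ¬ 2 ^ t ∣ x) :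
    |∑ y ∈ Ico (2 ^ n) (2 ^ (n + 1)), walsh S (x * y)|
      ≤ 2 ^ n * ((8 * lam + 9) ^ ((S ∩ Ico (lam - 2 * m) lam).card + 1)
        * (2 : ℝ) ^ (-((S ∩ Ico 0 (lam - 2 * m)).card : ℝ) / 16)) := by
  set L := lam - 2 * m with hL
  set A := S ∩ Ico 0 L with hA
  set B := S ∩ Ico L lam with hB
  obtain ⟨a, x', hx', rfl⟩ := Nat.exists_eq_two_pow_mul_odd hx0
  have hat : a + 1 ≤ t := by
    by_contra h
    exact hx (Dvd.dvd.mul_right (pow_dvd_pow 2 (by omega)) x')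
  have hAL : A ⊆ range L := fun j hj => mem_range.2 (mem_Ico.1 (mem_inter.1 hj).2).2
  have hBl : B ⊆ range lam := fun j hj => hS (mem_inter.1 hj).1
  have hdisj : Disjoint B A := by
    rw [disjoint_left]
    intro j hj hj'
    have h1 := mem_Ico.1 (mem_inter.1 hj).2
    have h2 := mem_Ico.1 (mem_inter.1 hj').2
    omega
  have hSAB : S = B ∪ A := by
    rw [hA, hB, ← inter_union_distrib_left, eq_comm, inter_eq_left]
    intro j hj
    have := mem_range.1 (hS hj)
    rw [mem_union, mem_Ico, mem_Ico]
    omega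
  have hn : 2 ^ n = 2 ^ L * 2 ^ m := by
    rw [← pow_add]
    congr 1
    omega
  set E : ℝ := (2 ^ m : ℕ) * (4 * (1 + L) * (2 ^ L * (2 : ℝ) ^ (-((A.card : ℝ) - a - 1) / 8)))
    with hE
  have hlow : ∀ β : ℝ, ‖∑ y ∈ Ico (2 ^ n) (2 ^ (n + 1)),
      (walsh A (2 ^ a * x' * y) : ℂ) * addExp (y * β)‖ ≤ E := by
    intro β
    rw [sum_Ico_eq_sum_range, show 2 ^ (n + 1) - 2 ^ n = 2 ^ n by rw [pow_succ]; omega, hn]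
    exact norm_sum_low_le hAL hx' β (2 ^ m) (2 ^ m)
  have hmain := norm_sum_walsh_mul_le _ _ (2 ^ a * x') hlow B hBl 0
  have hnorm : |∑ y ∈ Ico (2 ^ n) (2 ^ (n + 1)), walsh S (2 ^ a * x' * y)|
      = ‖∑ y ∈ Ico (2 ^ n) (2 ^ (n + 1)), (walsh B (2 ^ a * x' * y) : ℂ) *
        ((walsh A (2 ^ a * x' * y) : ℂ) * addExp (y * 0))‖ := by
    rw [← Real.norm_eq_abs, ← Complex.norm_real, Complex.ofReal_sum]
    congr 1
    refine sum_congr rfl fun y _ => ?_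
    rw [mul_zero, addExp_zero, mul_one]
    conv_lhs => rw [hSAB, walsh_union hdisj]
    push_cast
    rfl
  rw [hnorm]
  refine hmain.trans ?_
  have hexp : (2 : ℝ) ^ (-((A.card : ℝ) - a - 1) / 8) ≤ (2 : ℝ) ^ (-(A.card : ℝ) / 16) := by
    apply Real.rpow_le_rpow_of_exponent_le (by norm_num)
    have : 2 * (a + 1) ≤ A.card := by omega
    have : 2 * ((a : ℝ) + 1) ≤ A.card := by exact_mod_cast this
    linarith
  have hLl : (L : ℝ) ≤ lam := by exact_mod_cast Nat.sub_le _ _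
  have hnR : (2 : ℝ) ^ n = 2 ^ L * 2 ^ m := by exact_mod_cast hn
  have h4 : (4 * (1 + (L : ℝ))) ≤ 8 * lam + 9 := by
    have : (0 : ℝ) ≤ lam := Nat.cast_nonneg _
    linarith
  calc (8 * (lam : ℝ) + 9) ^ B.card * E
      = (8 * (lam : ℝ) + 9) ^ B.card * ((4 * (1 + L)) *
        (2 ^ n * (2 : ℝ) ^ (-((A.card : ℝ) - a - 1) / 8))) := by
        rw [hE, hnR]
        push_cast
        ring
    _ ≤ (8 * (lam : ℝ) + 9) ^ B.card * ((8 * lam + 9) *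
        (2 ^ n * (2 : ℝ) ^ (-(A.card : ℝ) / 16))) := by gcongr
    _ = _ := by ring

lemma exists_growth_bound :
    ∃ lam₀ : ℕ, ∀ lam : ℕ, lam₀ ≤ lam → ∀ H : ℝ, 1 ≤ H → H ≤ (lam : ℝ) ^ ((1 : ℝ) / 10) →
      4 ≤ Real.sqrt lam / H ∧
        (H + 1) * Real.logb 2 (8 * lam + 9) + 1 ≤ Real.sqrt lam / H / 32 := by
  have h1 : ∀ᶠ x : ℝ in Filter.atTop, Real.log x ≤ x ^ ((1 : ℝ) / 10) := by
    filter_upwards [(isLittleO_log_rpow_atTop (r := 1 / 10) (by norm_num)).bound one_pos,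
      Filter.eventually_ge_atTop 1] with x hx hx1
    rw [one_mul, Real.norm_eq_abs, Real.norm_eq_abs, 
      abs_of_nonneg (Real.rpow_nonneg (by linarith) _)] at hx
    exact (le_abs_self _).trans hx
  have h2 : ∀ᶠ x : ℝ in Filter.atTop, 17 ≤ x ^ ((1 : ℝ) / 10) :=
    (tendsto_rpow_atTop (by norm_num)).eventually_ge_atTop 17
  obtain ⟨lam₀, h⟩ := Filter.eventually_atTop.1
    (tendsto_natCast_atTop_atTop.eventually (h1.and (h2.and (Filter.eventually_ge_atTop 1))))
  refine ⟨lam₀, fun lam hlam H hH1 hH2 => ?_⟩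
  obtain ⟨hlog, hu, hlam1⟩ := h lam hlam
  set u : ℝ := (lam : ℝ) ^ ((1 : ℝ) / 10) with hu_def
  have hu0 : 0 ≤ u := by linarith
  have hsqrt : Real.sqrt lam = u ^ 5 := by
    rw [Real.sqrt_eq_rpow, hu_def, ← Real.rpow_natCast, ← Real.rpow_mul (by linarith)]
    norm_num
  have hH0 : 0 < H := by linarith
  have hs : u ^ 4 ≤ Real.sqrt lam / H := by
    rw [hsqrt, le_div_iff₀ hH0]
    calc u ^ 4 * H ≤ u ^ 4 * u := by gcongr
      _ = u ^ 5 := by ring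
  have hu2 : 288 ≤ u ^ 2 := by nlinarith
  have hu4 : 288 * u ^ 2 ≤ u ^ 4 := by nlinarith [sq_nonneg u]
  refine ⟨by linarith, ?_⟩
  have hlog2 : Real.logb 2 (8 * lam + 9) ≤ 4 * u := by
    rw [Real.logb, div_le_iff₀ (Real.log_pos (by norm_num))]
    have hle : Real.log (8 * lam + 9) ≤ Real.log (32 * lam) :=
      Real.log_le_log (by linarith) (by linarith)
    have h32 : Real.log (32 * lam) = 5 * Real.log 2 + Real.log lam := by
      rw [Real.log_mul (by norm_num) (by linarith), show (32 : ℝ) = 2 ^ 5 by norm_num, Real.log_pow]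
      norm_num
    have := Real.log_two_gt_d9
    have := Real.log_two_lt_d9
    nlinarith
  have hlog0 : 0 ≤ Real.logb 2 (8 * lam + 9) :=
    Real.logb_nonneg (by norm_num) (by linarith)
  have : (H + 1) * Real.logb 2 (8 * lam + 9) ≤ (2 * u) * (4 * u) := by
    gcongr
    linarith
  nlinarith

/-- refined type-I estimate (3.8)–(3.9). -/
theorem typeI_sum_estimate_refined :
    ∃ c C : ℝ, 0 < c ∧ 0 < C ∧
      ∃ lam₀ : ℕ, ∀ lam : ℕ, lam₀ ≤ lam →
        ∀ H : ℝ, C ≤ H → H ≤ (lam : ℝ) ^ ((1 : ℝ) / 10) →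
          ∀ m n : ℕ, m + n = lam → H < (m : ℝ) →
            (m : ℝ) ≤ C * H ^ 2 * Real.sqrt lam → 2 * m < lam →
            ∀ S ⊆ Finset.range lam,
              ((S ∩ Finset.Ico (lam - 2 * m) lam).card : ℝ) ≤ C * H →
              Real.sqrt lam / H ≤ ((S ∩ Finset.Ico 0 (lam - 2 * m)).card : ℝ) →
              ∑ x ∈ Finset.Ico (2 ^ m) (2 ^ (m + 1)),
                  |∑ y ∈ Finset.Ico (2 ^ n) (2 ^ (n + 1)), walsh S (x * y)|
                ≤ (2 : ℝ) ^ ((lam : ℝ) - c * Real.sqrt lam / H) := by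
  refine ⟨1 / 32, 1, by norm_num, by norm_num, ?_⟩
  obtain ⟨lam₀, hgrowth⟩ := exists_growth_bound
  refine ⟨lam₀, fun lam hlam H hH1 hH2 m n hmn _ _ hm S hS hSB hSA => ?_⟩
  obtain ⟨hs4, hbig⟩ := hgrowth lam hlam H hH1 hH2
  set s : ℝ := Real.sqrt lam / H with hs
  set L := lam - 2 * m
  set σ := (S ∩ Ico 0 L).card
  set k := (S ∩ Ico L lam).card
  obtain ⟨t, ht⟩ : ∃ t, t = σ / 2 := ⟨_, rfl⟩
  set P : ℝ := (8 * lam + 9) ^ (k + 1) * (2 : ℝ) ^ (-(σ : ℝ) / 16) with hP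
  have hP0 : 0 ≤ P := by positivity
  have hsplit := sum_filter_add_sum_filter_not (Ico (2 ^ m) (2 ^ (m + 1))) (2 ^ t ∣ ·)
    (fun x => |∑ y ∈ Ico (2 ^ n) (2 ^ (n + 1)), walsh S (x * y)|)
  rw [← hsplit]
  have hcardn : (Ico (2 ^ n) (2 ^ (n + 1))).card = 2 ^ n := by
    rw [Nat.card_Ico, pow_succ]
    omega
  have hcardm : (Ico (2 ^ m) (2 ^ (m + 1))).card = 2 ^ m := by
    rw [Nat.card_Ico, pow_succ]
    omega
  have hlam2 : (2 : ℝ) ^ (lam : ℝ) = 2 ^ m * 2 ^ n := by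
    rw [Real.rpow_natCast, ← hmn, pow_add]
  have hfirst : ∑ x ∈ (Ico (2 ^ m) (2 ^ (m + 1))).filter (2 ^ t ∣ ·),
      |∑ y ∈ Ico (2 ^ n) (2 ^ (n + 1)), walsh S (x * y)|
      ≤ 2 ^ (lam : ℝ) * ((2 : ℝ) ^ (-(t : ℝ))) := by
    have htriv : ∀ x ∈ (Ico (2 ^ m) (2 ^ (m + 1))).filter (2 ^ t ∣ ·),
        |∑ y ∈ Ico (2 ^ n) (2 ^ (n + 1)), walsh S (x * y)| ≤ 2 ^ n := by
      intro x _
      refine (abs_sum_le_sum_abs _ _).trans ?_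
      simp only [abs_walsh_s16, sum_const, hcardn, nsmul_eq_mul, mul_one]
      push_cast
      exact le_rfl
    refine (sum_le_sum htriv).trans ?_
    rw [sum_const, nsmul_eq_mul, Real.rpow_neg (by norm_num), ← div_eq_mul_inv,
      Real.rpow_natCast 2 t, le_div_iff₀ (by positivity), hlam2]
    have h : (((Ico (2 ^ m) (2 ^ (m + 1))).filter (2 ^ t ∣ ·)).card : ℝ) * 2 ^ t ≤ 2 ^ m := by
      exact_mod_cast card_filter_two_pow_dvd_mul_le m t
    have h2n : (0 : ℝ) < 2 ^ n := by positivity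
    nlinarith
  have hsecond : ∑ x ∈ (Ico (2 ^ m) (2 ^ (m + 1))).filter (¬ 2 ^ t ∣ ·),
      |∑ y ∈ Ico (2 ^ n) (2 ^ (n + 1)), walsh S (x * y)| ≤ 2 ^ (lam : ℝ) * P := by
    calc _ ≤ ∑ x ∈ (Ico (2 ^ m) (2 ^ (m + 1))).filter (¬ 2 ^ t ∣ ·), 2 ^ n * P := by
          refine sum_le_sum fun x hx => ?_
          obtain ⟨hx1, hx2⟩ := mem_filter.1 hx
          have hx0 : x ≠ 0 := ((Nat.two_pow_pos m).trans_le (mem_Ico.1 hx1).1).ne'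
          exact abs_sum_walsh_le hmn hm hS hx0 ht hx2
      _ ≤ ∑ x ∈ Ico (2 ^ m) (2 ^ (m + 1)), 2 ^ n * P :=
          sum_le_sum_of_subset_of_nonneg (filter_subset _ _) fun _ _ _ => by positivity
      _ = _ := by
          rw [sum_const, hcardm, nsmul_eq_mul, hlam2]
          push_cast
          ring
  have hhalf : (2 : ℝ) ^ (-(s / 32) - 1) = (2 : ℝ) ^ (-(s / 32)) / 2 := by
    rw [Real.rpow_sub (by norm_num), Real.rpow_one]
  have htb : (2 : ℝ) ^ (-(t : ℝ)) ≤ (2 : ℝ) ^ (-(s / 32) - 1) := by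
    apply Real.rpow_le_rpow_of_exponent_le (by norm_num)
    have : σ ≤ 2 * t + 1 := by omega
    have : (σ : ℝ) ≤ 2 * t + 1 := by exact_mod_cast this
    linarith
  have hPb : P ≤ (2 : ℝ) ^ (-(s / 32) - 1) := by
    have hbase : (0 : ℝ) < 8 * lam + 9 := by positivity
    have hlog0 : 0 ≤ Real.logb 2 (8 * lam + 9) := by
      refine Real.logb_nonneg (by norm_num) ?_
      have : (0 : ℝ) ≤ lam := Nat.cast_nonneg _
      linarith
    have hpow : (8 * (lam : ℝ) + 9) ^ (k + 1)
        = (2 : ℝ) ^ (((k : ℝ) + 1) * Real.logb 2 (8 * lam + 9)) := by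
      rw [mul_comm ((k : ℝ) + 1), Real.rpow_mul (by norm_num),
        Real.rpow_logb (by norm_num) (by norm_num) hbase]
      rw [← Nat.cast_add_one, Real.rpow_natCast]
    rw [hP, hpow, ← Real.rpow_add (by norm_num)]
    apply Real.rpow_le_rpow_of_exponent_le (by norm_num)
    have : ((k : ℝ) + 1) * Real.logb 2 (8 * lam + 9) ≤ (H + 1) * Real.logb 2 (8 * lam + 9) := by
      gcongr
      linarith
    linarith
  have hfinal : (2 : ℝ) ^ ((lam : ℝ) - 1 / 32 * Real.sqrt lam / H)
      = 2 ^ (lam : ℝ) * (2 : ℝ) ^ (-(s / 32)) := by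
    rw [← Real.rpow_add (by norm_num), hs]
    congr 1
    ring
  rw [hfinal]
  have h2l : (0 : ℝ) < 2 ^ (lam : ℝ) := by positivity
  nlinarith
end
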